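/- Let φ : (X,S) → (Y,T) be a surjective morphism of transformation semigroups (a pair of surjections on states and on semigroup elements, compatible with the actions, sending the identity on X to the identity on Y if present). Then φ induces a surjective order-preserving map from the partial order of subduction equivalence classes of I(X) (the skeleton of (X,S)) onto the partial order of subduction equivalence classes of I(Y) (the skeleton of (Y,T)), sending the class of P ∈ I(X) to the class of φ(P) ∈ I(Y). -/

import Mathlib

/-- A transformation semigroup on the state set `X`: a set of self-maps of `X`
closed under composition. With the right-action convention `x^(st) = (x^s)^t`,
the semigroup product `s * t` corresponds to the function `t ∘ s`. -/
structure TransSgp (X : Type*) where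
  carrier : Set (X → X)
  comp_mem : ∀ {s t : X → X}, s ∈ carrier → t ∈ carrier → (t ∘ s) ∈ carrier

namespace TransSgp

variable {X : Type*} (T : TransSgp X)

/-- `S¹`: the semigroup together with the identity map adjoined. -/
def S1 : Set (X → X) := insert id T.carrier

/-- The image set `I(X) = { im(s) : s ∈ S¹ }`. -/
def ImageSet : Set (Set X) := {P | ∃ s ∈ T.S1, P = Set.range s}

/-- The subduction relation: `P ⊆_S Q` iff `P ⊆ Q^s` for some `s ∈ S¹`. -/
def Subd (P Q : Set X) : Prop := ∃ s ∈ T.S1, P ⊆ s '' Q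

/-- Subduction equivalence: mutual subduction. -/
def SubdEquiv (P Q : Set X) : Prop := T.Subd P Q ∧ T.Subd Q P

/-- Green's `≤_L` preorder: `a ≤_L b` iff `a ∈ S¹ b`, i.e. `a = u·b = b ∘ u`. -/
def Lle (a b : X → X) : Prop := ∃ u ∈ T.S1, a = b ∘ u

/-- Green's `≤_J` preorder: `a ≤_J b` iff `a ∈ S¹ b S¹`, i.e. `a = u·b·v = v ∘ b ∘ u`. -/
def Jle (a b : X → X) : Prop := ∃ u ∈ T.S1, ∃ v ∈ T.S1, a = v ∘ b ∘ u

/-- Green's `L`-equivalence. -/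
def LEquiv (a b : X → X) : Prop := T.Lle a b ∧ T.Lle b a

/-- Green's `J`-equivalence. -/
def JEquiv (a b : X → X) : Prop := T.Jle a b ∧ T.Jle b a

end TransSgp

namespace TransSgp

theorem comp_mem_S1 {X : Type*} (T : TransSgp X) {s t : X → X} (hs : s ∈ T.S1)
    (ht : t ∈ T.S1) : t ∘ s ∈ T.S1 := by
  rcases hs with rfl | hs
  · exact ht
  · rcases ht with rfl | ht
    · exact Or.inr hs
    · exact Or.inr (T.comp_mem hs ht)

theorem Subd.refl {X : Type*} (T : TransSgp X) (P : Set X) : T.Subd P P :=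
  ⟨id, Or.inl rfl, by simp⟩

theorem Subd.trans {X : Type*} {T : TransSgp X} {P Q R : Set X} (hPQ : T.Subd P Q)
    (hQR : T.Subd Q R) : T.Subd P R := by
  obtain ⟨s, hs, hPQ⟩ := hPQ
  obtain ⟨t, ht, hQR⟩ := hQR
  refine ⟨s ∘ t, T.comp_mem_S1 ht hs, hPQ.trans ?_⟩
  rw [Set.image_comp]
  exact Set.image_mono hQR

theorem equivalence_subdEquiv {X : Type*} (T : TransSgp X) : Equivalence T.SubdEquiv where
  refl P := ⟨Subd.refl T P, Subd.refl T P⟩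
  symm h := ⟨h.2, h.1⟩
  trans h k := ⟨h.1.trans k.1, k.2.trans h.2⟩

/-- Subduction is preserved by a map `f` along which every element of `S¹` descends. -/
theorem Subd.image {X Y : Type*} {T : TransSgp X} {U : TransSgp Y} {f : X → Y}
    (hf : ∀ s ∈ T.S1, ∃ t ∈ U.S1, f ∘ s = t ∘ f) {P Q : Set X} (h : T.Subd P Q) :
    U.Subd (f '' P) (f '' Q) := by
  obtain ⟨s, hs, hPQ⟩ := h
  obtain ⟨t, ht, hst⟩ := hf s hs
  refine ⟨t, ht, ?_⟩
  rw [← Set.image_comp, ← hst, Set.image_comp]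
  exact Set.image_mono hPQ

theorem image_range_of_semiconj {X Y : Type*} {f : X → Y} (hf : Function.Surjective f)
    {s : X → X} {t : Y → Y} (hst : f ∘ s = t ∘ f) : f '' Set.range s = Set.range t := by
  rw [← Set.range_comp, hst, hf.range_comp]

end TransSgp

/-- A surjective morphism `φ : (X,S) → (Y,T)` of transformation
semigroups (surjective on states and on semigroup elements, compatible with the actions,
identity to identity if present) induces a surjective order-preserving map from the
skeleton of `(X,S)` (the partial order of subduction classes of `I(X)`) onto the
skeleton of `(Y,T)`, sending the class of `P ∈ I(X)` to the class of `φ(P) ∈ I(Y)`. -/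
theorem morphism_induces_skeleton_surjection {X Y : Type*} [Finite X] [Finite Y]
    (T : TransSgp X) (U : TransSgp Y) (f : X → Y) (g : (X → X) → (Y → Y))
    (hfsurj : Function.Surjective f)
    (hg : ∀ s ∈ T.carrier, g s ∈ U.carrier)
    (hgsurj : ∀ t ∈ U.carrier, ∃ s ∈ T.carrier, g s = t)
    (hghom : ∀ s ∈ T.carrier, ∀ t ∈ T.carrier, g (t ∘ s) = g t ∘ g s)
    (hcompat : ∀ s ∈ T.carrier, ∀ x : X, f (s x) = g s (f x))
    (hid : id ∈ T.carrier → g id = id) :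
    ∃ (eX : Equivalence fun P Q : T.ImageSet => T.SubdEquiv P.1 Q.1)
      (eY : Equivalence fun P Q : U.ImageSet => U.SubdEquiv P.1 Q.1),
      let sX : Setoid T.ImageSet := ⟨fun P Q => T.SubdEquiv P.1 Q.1, eX⟩
      let sY : Setoid U.ImageSet := ⟨fun P Q => U.SubdEquiv P.1 Q.1, eY⟩
      let rX : Quotient sX → Quotient sX → Prop := fun x y =>
        ∃ P Q : T.ImageSet, x = Quotient.mk sX P ∧ y = Quotient.mk sX Q ∧ T.Subd P.1 Q.1
      let rY : Quotient sY → Quotient sY → Prop := fun x y =>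
        ∃ P Q : U.ImageSet, x = Quotient.mk sY P ∧ y = Quotient.mk sY Q ∧ U.Subd P.1 Q.1
      ∃ F : Quotient sX → Quotient sY,
        (∀ (P : T.ImageSet) (Q : U.ImageSet), f '' P.1 = Q.1 →
          F (Quotient.mk sX P) = Quotient.mk sY Q) ∧
        Function.Surjective F ∧
        (∀ x y : Quotient sX, rX x y → rY (F x) (F y)) := by
  have hdown : ∀ s ∈ T.S1, ∃ t ∈ U.S1, f ∘ s = t ∘ f := by
    rintro s (rfl | hs)
    · exact ⟨id, Or.inl rfl, rfl⟩
    · exact ⟨g s, Or.inr (hg s hs), funext (hcompat s hs)⟩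
  have hup : ∀ t ∈ U.S1, ∃ s ∈ T.S1, f ∘ s = t ∘ f := by
    rintro t (rfl | ht)
    · exact ⟨id, Or.inl rfl, rfl⟩
    · obtain ⟨s, hs, rfl⟩ := hgsurj t ht
      exact ⟨s, Or.inr hs, funext (hcompat s hs)⟩
  have himage : ∀ P : T.ImageSet, f '' P.1 ∈ U.ImageSet := by
    rintro ⟨_, s, hs, rfl⟩
    obtain ⟨t, ht, hst⟩ := hdown s hs
    exact ⟨t, ht, TransSgp.image_range_of_semiconj hfsurj hst⟩
  refine ⟨T.equivalence_subdEquiv.comap Subtype.val,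
    U.equivalence_subdEquiv.comap Subtype.val, ?_⟩
  intro sX sY rX rY
  let F : Quotient sX → Quotient sY :=
    Quotient.map (fun P => ⟨f '' P.1, himage P⟩)
      fun _ _ h => ⟨TransSgp.Subd.image hdown h.1, TransSgp.Subd.image hdown h.2⟩
  have hF : ∀ (P : T.ImageSet) (Q : U.ImageSet), f '' P.1 = Q.1 →
      F (Quotient.mk sX P) = Quotient.mk sY Q :=
    fun P Q h => congrArg (Quotient.mk sY) (Subtype.ext h)
  refine ⟨F, hF, ?_, ?_⟩
  · intro y
    induction y using Quotient.inductionOn with | _ Q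
    obtain ⟨_, t, ht, rfl⟩ := Q
    obtain ⟨s, hs, hst⟩ := hup t ht
    exact ⟨Quotient.mk sX ⟨Set.range s, s, hs, rfl⟩,
      hF _ _ (TransSgp.image_range_of_semiconj hfsurj hst)⟩
  · rintro _ _ ⟨P, Q, rfl, rfl, h⟩
    exact ⟨⟨f '' P.1, himage P⟩, ⟨f '' Q.1, himage Q⟩, rfl, rfl,
      TransSgp.Subd.image hdown h⟩
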